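/- Let p ∈ (1,∞] and let X denote either W^{1,p} or C^{0,1−1/p}. Suppose that every x₀ ∈ C^{0,1−1/p} admits a solution of ẋ(t) = f(x_t) on [0,∞) (write φ(t,x₀) := x_t). Then the following are equivalent: (a) Lyapunov stability in X (for every ε > 0 there exists δ > 0 such that ‖φ(t,x₀)‖_X ≤ ε for all t ≥ 0 and all x₀ ∈ X with ‖x₀‖_X ≤ δ) together with global attractivity in X (for every x₀ ∈ X, ‖φ(t,x₀)‖_X → 0 as t → ∞); (b) there exists a class-KL function σ such that ‖φ(t,x₀)‖_X ≤ σ(‖x₀‖_X, t) for all t ≥ 0 and all x₀ ∈ X. -/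

import Mathlib

open Set MeasureTheory Filter Topology
open scoped ENNReal NNReal

noncomputable section

abbrev Vec (n : ℕ) := EuclideanSpace ℝ (Fin n)

variable {n : ℕ}

/-- The segment `x_t` of a history `x : ℝ → ℝⁿ`, i.e. `x_t(s) = x(t+s)`
(only its values on `[-r,0]` are relevant). -/
def seg (r : ℝ) (x : ℝ → Vec n) (t : ℝ) : ℝ → Vec n := fun s => x (t + s)

/-- Sup norm over `[-r,0]`. -/
def supN (r : ℝ) (g : ℝ → Vec n) : ℝ := sSup ((fun s => ‖g s‖) '' Icc (-r) 0)

/-- Membership in `C⁰ = C([-r,0];ℝⁿ)`. -/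
def MemC0 (r : ℝ) (g : ℝ → Vec n) : Prop := ContinuousOn g (Icc (-r) 0)

/-- `f` vanishes at `0`, depends only on the values of its argument on `[-r,0]`,
and is Lipschitz on bounded subsets of `C⁰` with a nondecreasing (nonnegative)
modulus `L`. -/
def GoodRHS (r : ℝ) (f : (ℝ → Vec n) → Vec n) (L : ℝ → ℝ) : Prop :=
  f 0 = 0 ∧
  (∀ x y : ℝ → Vec n, EqOn x y (Icc (-r) 0) → f x = f y) ∧
  Monotone L ∧ (∀ s : ℝ, 0 ≤ L s) ∧
  ∀ R : ℝ, ∀ x y : ℝ → Vec n, MemC0 r x → MemC0 r y → supN r x ≤ R → supN r y ≤ R →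
    ‖f x - f y‖ ≤ L R * supN r (x - y)

/-- `x : ℝ → ℝⁿ` is a solution on `[-r, b)` (with `b ∈ (0,∞]` an extended
nonnegative real) of the delay system `ẋ(t) = f(x_t)` with initial condition `x0`:
it is continuous on `[-r,b)`, coincides with `x0` on `[-r,0]`, and satisfies the
integral equation `x(t) = x(0) + ∫₀ᵗ f(x_s) ds` on `[0,b)`. -/
def IsSol (r : ℝ) (f : (ℝ → Vec n) → Vec n) (x0 x : ℝ → Vec n) (b : ℝ≥0∞) : Prop :=
  ContinuousOn x {t : ℝ | -r ≤ t ∧ ENNReal.ofReal t < b} ∧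
  EqOn x x0 (Icc (-r) 0) ∧
  ∀ t : ℝ, 0 ≤ t → ENNReal.ofReal t < b → x t = x 0 + ∫ s in (0:ℝ)..t, f (seg r x s)

/-- Class `KL` functions `σ : [0,∞)×[0,∞) → [0,∞)`. -/
def ClassKL (σ : ℝ → ℝ → ℝ) : Prop :=
  (∀ s t : ℝ, 0 ≤ s → 0 ≤ t → 0 ≤ σ s t) ∧
  (∀ t : ℝ, 0 ≤ t →
    ContinuousOn (fun s => σ s t) (Ici 0) ∧ StrictMonoOn (fun s => σ s t) (Ici 0) ∧
      σ 0 t = 0) ∧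
  (∀ s : ℝ, 0 ≤ s →
    AntitoneOn (fun t => σ s t) (Ici 0) ∧ Tendsto (fun t => σ s t) atTop (nhds 0))

/-- Class `K∞` functions `a : [0,∞) → [0,∞)`. -/
def ClassKInf (a : ℝ → ℝ) : Prop :=
  (∀ s : ℝ, 0 ≤ s → 0 ≤ a s) ∧ ContinuousOn a (Ici 0) ∧ StrictMonoOn a (Ici 0) ∧
  a 0 = 0 ∧ Tendsto a atTop atTop

/-- The set of Hölder difference quotients `‖g t - g s‖ / |t-s|^α` over a set `S`. -/
def hRatios (α : ℝ) (S : Set ℝ) (g : ℝ → Vec n) : Set ℝ :=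
  {c | ∃ t ∈ S, ∃ s ∈ S, t ≠ s ∧ c = ‖g t - g s‖ / |t - s| ^ α}

/-- Membership in the Hölder space `C^{0,α}([-r,0])`. -/
def MemHol (r α : ℝ) (g : ℝ → Vec n) : Prop :=
  MemC0 r g ∧ BddAbove (hRatios α (Icc (-r) 0) g)

/-- The Hölder norm `max(‖g‖_∞, [g]_α)`. -/
def holderNorm (r α : ℝ) (g : ℝ → Vec n) : ℝ :=
  max (supN r g) (sSup (hRatios α (Icc (-r) 0) g))

/-- Membership in the Sobolev space `W^{1,p}([-r,0])`: `g` is absolutely continuous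
on `[-r,0]` (i.e. the integral of an integrable function `d`, which is then its a.e.
derivative) with `d ∈ L^p((-r,0))`. -/
def MemW (r : ℝ) (p : ℝ≥0∞) (g : ℝ → Vec n) : Prop :=
  ∃ d : ℝ → Vec n, IntegrableOn d (Icc (-r) 0) ∧
    eLpNorm d p (volume.restrict (Ioo (-r) 0)) < ⊤ ∧
    ∀ t ∈ Icc (-r) 0, g t = g (-r) + ∫ s in (-r)..t, d s

/-- The Sobolev norm `‖g‖_∞ + ‖ġ‖_p`; for an absolutely continuous `g` the a.e.
derivative coincides a.e. on `(-r,0)` with `deriv g`. -/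
def sobNorm (r : ℝ) (p : ℝ≥0∞) (g : ℝ → Vec n) : ℝ :=
  supN r g + (eLpNorm (deriv g) p (volume.restrict (Ioo (-r) 0))).toReal

/-- The Hölder exponent `1 - 1/p`, with the convention `1/∞ = 0`. -/
def hexp (p : ℝ≥0∞) : ℝ := 1 - (p.toReal)⁻¹

open Set MeasureTheory Filter Topology
/-- Comparison lemma producing a class `KL` bound. -/
theorem exists_KL (S : ℝ → ℝ → ℝ → Prop)
    (h1 : ∀ ε : ℝ, 0 < ε → ∃ δ : ℝ, 0 < δ ∧ ∀ s t v, S s t v → s ≤ δ → v ≤ ε)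
    (h2 : ∀ R ε : ℝ, 0 < ε → ∃ N : ℝ, ∀ s t v, S s t v → s ≤ R → (N ≤ t → v ≤ ε) ∧ v ≤ N) :
    ∃ σ : ℝ → ℝ → ℝ, ClassKL σ ∧ ∀ s t v, 0 ≤ s → 0 ≤ t → S s t v → v ≤ σ s t := by
  set A : ℝ → ℝ → Set ℝ := fun s t => insert 0 {v | ∃ s' t', s' ≤ s ∧ t ≤ t' ∧ S s' t' v} with hA
  set β : ℝ → ℝ → ℝ := fun s t => sSup (A s t) with hβ
  have hbdd : ∀ s t, BddAbove (A s t) := by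
    intro s t
    obtain ⟨N, hN⟩ := h2 s 1 one_pos
    refine ⟨max 0 N, ?_⟩
    rintro v (rfl | ⟨s', t', hs, -, hv⟩)
    · exact le_max_left _ _
    · exact (hN _ _ _ hv hs).2.trans (le_max_right _ _)
  have hne : ∀ s t, (A s t).Nonempty := fun s t => ⟨0, mem_insert _ _⟩
  have hβ0 : ∀ s t, 0 ≤ β s t := fun s t => le_csSup (hbdd s t) (mem_insert _ _)
  have hβle : ∀ s t c, 0 ≤ c → (∀ s' t' v, s' ≤ s → t ≤ t' → S s' t' v → v ≤ c) → β s t ≤ c := by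
    intro s t c hc h
    refine csSup_le (hne s t) ?_
    rintro v (rfl | ⟨s', t', hs, ht, hv⟩)
    · exact hc
    · exact h _ _ _ hs ht hv
  have hSβ : ∀ s t v, S s t v → v ≤ β s t := fun s t v h =>
    le_csSup (hbdd s t) (mem_insert_of_mem _ ⟨s, t, le_rfl, le_rfl, h⟩)
  have hmono : ∀ t, Monotone (fun s => β s t) := by
    intro t s s' hss
    refine csSup_le_csSup (hbdd s' t) (hne s t) (insert_subset_insert ?_)
    rintro v ⟨a, b, ha, hb, hv⟩
    exact ⟨a, b, ha.trans hss, hb, hv⟩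
  have hanti : ∀ s, Antitone (fun t => β s t) := by
    intro s t t' htt
    refine csSup_le_csSup (hbdd s t) (hne s t') (insert_subset_insert ?_)
    rintro v ⟨a, b, ha, hb, hv⟩
    exact ⟨a, b, ha, htt.trans hb, hv⟩
  have hβsmall : ∀ ε : ℝ, 0 < ε → ∃ δ : ℝ, 0 < δ ∧ ∀ s t, s ≤ δ → β s t ≤ ε := by
    intro ε hε
    obtain ⟨δ, hδ, h⟩ := h1 ε hε
    exact ⟨δ, hδ, fun s t hs => hβle _ _ _ hε.le fun s' t' v hs' _ hv => h _ _ _ hv (hs'.trans hs)⟩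
  have hβz : ∀ t, β 0 t = 0 := by
    intro t
    refine le_antisymm (le_of_forall_pos_le_add fun ε hε => ?_) (hβ0 _ _)
    obtain ⟨δ, hδ, h⟩ := hβsmall ε hε
    simpa using h 0 t hδ.le
  have hβlim : ∀ s ε : ℝ, 0 < ε → ∃ N : ℝ, ∀ t, N ≤ t → β s t ≤ ε := by
    intro s ε hε
    obtain ⟨N, hN⟩ := h2 s ε hε
    exact ⟨N, fun t ht => hβle _ _ _ hε.le fun s' t' v hs' ht' hv =>
      (hN _ _ _ hv hs').1 (ht.trans ht')⟩
  have hint : ∀ t a b, IntervalIntegrable (fun u => β u t) volume a b :=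
    fun t a b => (hmono t).intervalIntegrable
  have hint' : ∀ t s, 0 ≤ s → IntervalIntegrable (fun u => β (s * u) t) volume 1 2 := by
    intro t s hs
    refine Monotone.intervalIntegrable ?_
    intro u u' huu
    exact hmono t (mul_le_mul_of_nonneg_left huu hs)
  set I : ℝ → ℝ → ℝ := fun s t => ∫ u in (1:ℝ)..2, β (s * u) t with hI
  have hIle : ∀ s t, 0 ≤ s → I s t ≤ β (2 * s) t := by
    intro s t hs
    have : I s t ≤ ∫ u in (1:ℝ)..2, β (2 * s) t := by
      refine intervalIntegral.integral_mono_on (by norm_num) (hint' t s hs) (by simp) ?_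
      intro u hu
      exact hmono t (by nlinarith [hu.2])
    refine this.trans (le_of_eq ?_)
    rw [intervalIntegral.integral_const]; norm_num
  have hleI : ∀ s t, 0 ≤ s → β s t ≤ I s t := by
    intro s t hs
    have : (∫ u in (1:ℝ)..2, β s t) ≤ I s t := by
      refine intervalIntegral.integral_mono_on (by norm_num) (by simp) (hint' t s hs) ?_
      intro u hu
      exact hmono t (by nlinarith [hu.1])
    refine le_trans (le_of_eq ?_) this
    rw [intervalIntegral.integral_const]; norm_num
  have hI0 : ∀ s t, 0 ≤ s → 0 ≤ I s t := fun s t hs => (hβ0 s t).trans (hleI s t hs)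
  have hImono : ∀ t s s', 0 ≤ s → s ≤ s' → I s t ≤ I s' t := by
    intro t s s' hs hss
    refine intervalIntegral.integral_mono_on (by norm_num) (hint' t s hs)
      (hint' t s' (hs.trans hss)) ?_
    intro u hu
    exact hmono t (mul_le_mul_of_nonneg_right hss (by linarith [hu.1]))
  have hIanti : ∀ s t t', 0 ≤ s → t ≤ t' → I s t' ≤ I s t := by
    intro s t t' hs htt
    refine intervalIntegral.integral_mono_on (by norm_num) (hint' t' s hs) (hint' t s hs) ?_
    intro u hu
    exact hanti _ htt
  have hIz : ∀ t, I 0 t = 0 := by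
    intro t
    exact le_antisymm ((hIle 0 t le_rfl).trans (by simp [hβz])) (hI0 0 t le_rfl)
  have hIcont : ∀ t, ContinuousOn (fun s => I s t) (Ici 0) := by
    intro t s hs
    rcases (mem_Ici.1 hs).eq_or_lt with h | h
    · subst h
      rw [Metric.continuousWithinAt_iff]
      intro ε hε
      obtain ⟨δ, hδ, hd⟩ := hβsmall (ε / 2) (by linarith)
      refine ⟨δ / 2, by linarith, fun {s} hs hsd => ?_⟩
      have hs' : 0 ≤ s := hs
      rw [Real.dist_eq, sub_zero, abs_of_nonneg hs'] at hsd
      simp only [hIz, Real.dist_eq, sub_zero]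
      rw [abs_of_nonneg (hI0 s t hs')]
      have := hd (2 * s) t (by linarith)
      linarith [hIle s t hs']
    · refine ContinuousAt.continuousWithinAt ?_
      have hp : Continuous (fun y => ∫ u in (0:ℝ)..y, β u t) :=
        intervalIntegral.continuous_primitive (fun a b => hint t a b) 0
      have hEq : (fun s => I s t) =ᶠ[𝓝 s] fun s => s⁻¹ * ((∫ u in (0:ℝ)..(s * 2), β u t) -
          ∫ u in (0:ℝ)..s, β u t) := by
        filter_upwards [lt_mem_nhds h] with y hy
        rw [intervalIntegral.integral_interval_sub_left (hint t _ _) (hint t _ _)]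
        simp only [hI]
        rw [intervalIntegral.integral_comp_mul_left (fun u => β u t) hy.ne']
        simp
      refine ContinuousAt.congr ?_ hEq.symm
      refine (continuousAt_inv₀ h.ne').mul ?_
      exact ((hp.comp (continuous_id.mul continuous_const)).sub hp).continuousAt
  refine ⟨fun s t => I s t + s * Real.exp (-t), ⟨?_, ?_, ?_⟩, ?_⟩
  · intro s t hs ht
    have := hI0 s t hs
    positivity
  · intro t ht
    refine ⟨(hIcont t).add (by fun_prop), ?_, by simp [hIz]⟩
    intro s hs s' hs' hss
    have := hImono t s s' hs hss.le
    have h3 : s * Real.exp (-t) < s' * Real.exp (-t) := mul_lt_mul_of_pos_right hss (Real.exp_pos _)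
    simp only
    linarith
  · intro s hs
    refine ⟨?_, ?_⟩
    · intro t _ t' _ htt
      have := hIanti s t t' hs htt
      have h3 : s * Real.exp (-t') ≤ s * Real.exp (-t) :=
        mul_le_mul_of_nonneg_left (Real.exp_le_exp.2 (by linarith)) hs
      simp only
      linarith
    · have e1 : Tendsto (fun t => I s t) atTop (𝓝 0) := by
        rw [Metric.tendsto_atTop]
        intro ε hε
        obtain ⟨N, hN⟩ := hβlim (2 * s) (ε / 2) (by linarith)
        refine ⟨N, fun t ht => ?_⟩
        rw [Real.dist_eq, sub_zero, abs_of_nonneg (hI0 s t hs)]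
        linarith [hN t ht, hIle s t hs]
      have e2 : Tendsto (fun t => s * Real.exp (-t)) atTop (𝓝 (s * 0)) :=
        (Real.tendsto_exp_neg_atTop_nhds_zero).const_mul s
      simpa using e1.add e2
  · intro s t v hs ht hv
    have := hSβ s t v hv
    have h3 := hleI s t hs
    have : 0 ≤ s * Real.exp (-t) := by positivity
    simp only
    linarith

theorem supN_nonneg (r : ℝ) (g : ℝ → Vec n) : 0 ≤ supN r g := by
  refine Real.sSup_nonneg ?_
  rintro _ ⟨s, -, rfl⟩
  exact norm_nonneg _

theorem supN_le {r : ℝ} {g : ℝ → Vec n} {c : ℝ} (hc : 0 ≤ c)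
    (h : ∀ s ∈ Icc (-r) 0, ‖g s‖ ≤ c) : supN r g ≤ c := by
  refine Real.sSup_le ?_ hc
  rintro _ ⟨s, hs, rfl⟩
  exact h s hs

theorem le_supN {r : ℝ} {g : ℝ → Vec n} (hg : MemC0 r g) {s : ℝ} (hs : s ∈ Icc (-r) 0) :
    ‖g s‖ ≤ supN r g := by
  refine le_csSup ?_ ⟨s, hs, rfl⟩
  exact (isCompact_Icc.image_of_continuousOn hg.norm).bddAbove

theorem seg_memC0 {r : ℝ} {x : ℝ → Vec n} (hx : ContinuousOn x (Ici (-r))) {t : ℝ} (ht : 0 ≤ t) :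
    MemC0 r (seg r x t) := by
  refine hx.comp (by fun_prop) ?_
  intro s hs
  simp only [mem_Ici]
  linarith [hs.1]

theorem sol_cont {r : ℝ} {f : (ℝ → Vec n) → Vec n} {x0 x : ℝ → Vec n}
    (h : IsSol r f x0 x ⊤) : ContinuousOn x (Ici (-r)) := by
  refine h.1.mono ?_
  intro t ht
  exact ⟨ht, ENNReal.ofReal_lt_top⟩

theorem fseg_cont {r : ℝ} (hr : 0 < r) {f : (ℝ → Vec n) → Vec n} {L : ℝ → ℝ} (hf : GoodRHS r f L)
    {x : ℝ → Vec n} (hx : ContinuousOn x (Ici (-r))) :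
    ContinuousOn (fun t => f (seg r x t)) (Ici 0) := by
  obtain ⟨-, -, -, hL, hlip⟩ := hf
  intro t ht
  have ht0 : 0 ≤ t := ht
  have hx' : ContinuousOn x (Icc (-r) (t + 1)) := hx.mono fun s hs => hs.1
  obtain ⟨M, hM⟩ := (isCompact_Icc (a := -r) (b := t + 1)).exists_bound_of_continuousOn hx'
  have hM0 : 0 ≤ M := (norm_nonneg _).trans (hM (-r) ⟨le_rfl, by linarith⟩)
  have huc := (isCompact_Icc (a := -r) (b := t + 1)).uniformContinuousOn_of_continuous hx'
  rw [Metric.uniformContinuousOn_iff] at huc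
  rw [Metric.continuousWithinAt_iff]
  intro ε hε
  obtain ⟨δ, hδ, hd⟩ := huc (ε / (L M + 1) / 2) (by have := hL M; positivity)
  refine ⟨min δ 1, by positivity, fun {u} hu hut => ?_⟩
  have hu0 : 0 ≤ u := hu
  rw [Real.dist_eq] at hut
  have hu1 : |u - t| < 1 := hut.trans_le (min_le_right _ _)
  have hu2 : |u - t| < δ := hut.trans_le (min_le_left _ _)
  rw [abs_lt] at hu1
  have hb : ∀ v, 0 ≤ v → v ≤ t + 1 → supN r (seg r x v) ≤ M := by
    intro v hv hv1
    refine supN_le hM0 fun s hs => hM _ ⟨by linarith [hs.1], by linarith [hs.2]⟩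
  have h1 := hlip M _ _ (seg_memC0 hx hu0) (seg_memC0 hx ht0) (hb u hu0 (by linarith))
    (hb t ht0 (by linarith))
  have hLM := hL M
  have h2 : supN r (seg r x u - seg r x t) ≤ ε / (L M + 1) / 2 := by
    refine supN_le (by positivity) fun s hs => ?_
    have := hd (u + s) ⟨by linarith [hs.1], by linarith [hs.2]⟩ (t + s)
      ⟨by linarith [hs.1], by linarith [hs.2]⟩ (by rw [Real.dist_eq]; simpa using hu2)
    rw [dist_eq_norm] at this
    exact this.le
  rw [dist_eq_norm]
  calc ‖f (seg r x u) - f (seg r x t)‖ ≤ L M * supN r (seg r x u - seg r x t) := h1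
    _ ≤ (L M + 1) * (ε / (L M + 1) / 2) := by
        exact mul_le_mul (by linarith) h2 (supN_nonneg _ _) (by linarith)
    _ = ε / 2 := by field_simp
    _ < ε := by linarith

theorem fseg_int {r : ℝ} (hr : 0 < r) {f : (ℝ → Vec n) → Vec n} {L : ℝ → ℝ} (hf : GoodRHS r f L)
    {x : ℝ → Vec n} (hx : ContinuousOn x (Ici (-r))) {a b : ℝ} (ha : 0 ≤ a) (hb : 0 ≤ b) :
    IntervalIntegrable (fun t => f (seg r x t)) volume a b := by
  refine ContinuousOn.intervalIntegrable ((fseg_cont hr hf hx).mono ?_)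
  intro s hs
  exact (le_min ha hb).trans hs.1

theorem sol_sub {r : ℝ} (hr : 0 < r) {f : (ℝ → Vec n) → Vec n} {L : ℝ → ℝ} (hf : GoodRHS r f L)
    {x0 x : ℝ → Vec n} (h : IsSol r f x0 x ⊤) {a b : ℝ} (ha : 0 ≤ a) (hb : 0 ≤ b) :
    x b - x a = ∫ s in a..b, f (seg r x s) := by
  rw [h.2.2 a ha ENNReal.ofReal_lt_top, h.2.2 b hb ENNReal.ofReal_lt_top,
    ← intervalIntegral.integral_interval_sub_left
      (fseg_int hr hf (sol_cont h) le_rfl hb) (fseg_int hr hf (sol_cont h) le_rfl ha)]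
  abel

theorem sol_shift {r : ℝ} (hr : 0 < r) {f : (ℝ → Vec n) → Vec n} {L : ℝ → ℝ} (hf : GoodRHS r f L)
    {x0 x : ℝ → Vec n} (h : IsSol r f x0 x ⊤) {T : ℝ} (hT : 0 ≤ T) :
    IsSol r f (seg r x T) (seg r x T) ⊤ := by
  refine ⟨?_, fun _ _ => rfl, ?_⟩
  · refine (sol_cont h).comp (by fun_prop) ?_
    rintro s ⟨hs, -⟩
    simp only [mem_Ici]
    linarith
  · intro t ht _
    have h1 := sol_sub hr hf h hT (by linarith : 0 ≤ T + t)
    have h2 : ∫ s in (0:ℝ)..t, f (seg r (seg r x T) s) = ∫ s in T..(T + t), f (seg r x s) := by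
      have := intervalIntegral.integral_comp_add_left (fun s => f (seg r x s)) T (a := 0) (b := t)
      rw [add_zero] at this
      rw [← this]
      congr 1
      ext1 s
      congr 1
      ext1 u
      simp [seg, add_assoc]
    rw [h2, ← h1]
    simp [seg]

theorem seg_seg (r : ℝ) (x : ℝ → Vec n) (T t : ℝ) : seg r (seg r x T) t = seg r x (T + t) := by
  ext1 u
  simp [seg, add_assoc]

theorem sol_deriv {r : ℝ} (hr : 0 < r) {f : (ℝ → Vec n) → Vec n} {L : ℝ → ℝ} (hf : GoodRHS r f L)
    {x0 x : ℝ → Vec n} (h : IsSol r f x0 x ⊤) {t : ℝ} (ht : 0 < t) :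
    HasDerivAt x (f (seg r x t)) t := by
  have hc := fseg_cont hr hf (sol_cont h)
  have hc' : ContinuousOn (fun t => f (seg r x t)) (Ioi 0) := hc.mono Ioi_subset_Ici_self
  have h1 : HasDerivAt (fun u => x 0 + ∫ s in (0:ℝ)..u, f (seg r x s)) (f (seg r x t)) t := by
    refine HasDerivAt.const_add _ ?_
    refine intervalIntegral.integral_hasDerivAt_right (fseg_int hr hf (sol_cont h) le_rfl ht.le) ?_
      (hc'.continuousAt (Ioi_mem_nhds ht))
    exact hc'.stronglyMeasurableAtFilter isOpen_Ioi t ht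
  refine h1.congr_of_eventuallyEq ?_
  filter_upwards [Ioi_mem_nhds ht] with u hu
  exact h.2.2 u (le_of_lt hu) ENNReal.ofReal_lt_top

theorem sol_lip {r : ℝ} (hr : 0 < r) {f : (ℝ → Vec n) → Vec n} {L : ℝ → ℝ} (hf : GoodRHS r f L)
    {x0 x : ℝ → Vec n} (h : IsSol r f x0 x ⊤) {T K : ℝ}
    (hK : ∀ s ∈ Icc 0 T, ‖f (seg r x s)‖ ≤ K) {a b : ℝ} (ha : a ∈ Icc 0 T) (hb : b ∈ Icc 0 T) :
    ‖x a - x b‖ ≤ K * |a - b| := by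
  rw [sol_sub hr hf h hb.1 ha.1]
  refine intervalIntegral.norm_integral_le_of_norm_le_const ?_
  intro s hs
  have := uIcc_subset_Icc hb ha (uIoc_subset_uIcc hs)
  exact hK s this

theorem fseg_bound {r : ℝ} (hr : 0 < r) {f : (ℝ → Vec n) → Vec n} {L : ℝ → ℝ} (hf : GoodRHS r f L)
    {x : ℝ → Vec n} (hx : ContinuousOn x (Ici (-r))) (T : ℝ) :
    ∃ K, 0 ≤ K ∧ ∀ s ∈ Icc 0 T, ‖f (seg r x s)‖ ≤ K := by
  obtain ⟨K, hK⟩ := (isCompact_Icc (a := 0) (b := T)).exists_bound_of_continuousOn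
    ((fseg_cont hr hf hx).mono fun s hs => hs.1)
  exact ⟨max 0 K, le_max_left _ _, fun s hs => (hK s hs).trans (le_max_right _ _)⟩

/-- Continuous dependence on the initial condition. -/
theorem cont_dep {r : ℝ} (hr : 0 < r) {f : (ℝ → Vec n) → Vec n} {L : ℝ → ℝ} (hf : GoodRHS r f L)
    {y0 y : ℝ → Vec n} (hy : IsSol r f y0 y ⊤) {T : ℝ} (hT : 0 ≤ T) :
    ∃ M C δ0 : ℝ, 0 ≤ M ∧ 0 < C ∧ 0 < δ0 ∧ ∀ δ x0 x, 0 < δ → δ ≤ δ0 → IsSol r f x0 x ⊤ →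
      (∀ s ∈ Icc (-r) 0, ‖x0 s - y0 s‖ ≤ δ) →
      (∀ t ∈ Icc (-r) T, ‖x t‖ ≤ M) ∧ (∀ t ∈ Icc 0 T, ‖f (seg r x t)‖ ≤ L M * M) ∧
      (∀ t ∈ Icc (-r) T, ‖x t - y t‖ ≤ C * δ) ∧
      (∀ t ∈ Icc 0 T, ‖f (seg r x t) - f (seg r y t)‖ ≤ C * δ) := by
  have hf' := hf
  obtain ⟨hf0, -, -, hL, hlip⟩ := hf'
  have hyc := sol_cont hy
  obtain ⟨M0, hM0⟩ := (isCompact_Icc (a := -r) (b := T)).exists_bound_of_continuousOn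
    (hyc.mono fun s hs => hs.1)
  have hM00 : 0 ≤ M0 := (norm_nonneg _).trans (hM0 (-r) ⟨le_rfl, by linarith⟩)
  set M := M0 + 1 with hM
  have hMpos : 0 < M := by linarith
  set l := L M + 1 with hl
  have hLM := hL M
  have hlpos : 0 < l := by linarith
  set E := Real.exp (l * T) with hE
  have hEpos : 0 < E := Real.exp_pos _
  refine ⟨M, 2 * E * l, 1 / (2 * E), hMpos.le, by positivity, by positivity, ?_⟩
  intro δ x0 x hδ hδ0 hx hclose
  have hxc := sol_cont hx
  have hδE : 2 * δ * E ≤ 1 := by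
    rw [le_div_iff₀ (by positivity)] at hδ0
    linarith
  have hclose' : ∀ s ∈ Icc (-r) 0, ‖x s - y s‖ ≤ δ := by
    intro s hs
    rw [hx.2.1 hs, hy.2.1 hs]
    exact hclose s hs
  have hexpE : ∀ t, t ≤ T → Real.exp (l * t) ≤ E := fun t ht =>
    Real.exp_le_exp.2 (mul_le_mul_of_nonneg_left ht hlpos.le)
  -- consequences of closeness up to time `t`
  have key : ∀ t c, 0 ≤ t → t ≤ T → c ≤ 1 → 0 ≤ c → (∀ s ∈ Icc (-r) t, ‖x s - y s‖ ≤ c) →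
      ‖f (seg r x t) - f (seg r y t)‖ ≤ L M * c ∧ supN r (seg r x t) ≤ M := by
    intro t c ht htT hc hc0 hs
    have hmem : ∀ s ∈ Icc (-r) 0, t + s ∈ Icc (-r) t := fun s hs =>
      ⟨by linarith [hs.1], by linarith [hs.2]⟩
    have hy1 : supN r (seg r y t) ≤ M := by
      refine supN_le hMpos.le fun s hs' => ?_
      have := hM0 (t + s) ⟨(hmem s hs').1, (hmem s hs').2.trans htT⟩
      simp only [seg]
      linarith
    have hx1 : supN r (seg r x t) ≤ M := by
      refine supN_le hMpos.le fun s hs' => ?_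
      have h1 := hM0 (t + s) ⟨(hmem s hs').1, (hmem s hs').2.trans htT⟩
      have h2 := hs (t + s) (hmem s hs')
      have h3 := norm_le_norm_add_norm_sub (y (t + s)) (x (t + s))
      rw [norm_sub_rev] at h3
      simp only [seg]
      linarith
    refine ⟨?_, hx1⟩
    refine (hlip M _ _ (seg_memC0 hxc ht) (seg_memC0 hyc ht) hx1 hy1).trans ?_
    refine mul_le_mul_of_nonneg_left ?_ hLM
    exact supN_le hc0 fun s hs' => hs (t + s) (hmem s hs')
  have main : ∀ t ∈ Icc 0 T, ‖x t - y t‖ < 2 * δ * Real.exp (l * t) := by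
    by_contra hcon
    push Not at hcon
    set B : Set ℝ := {t ∈ Icc 0 T | 2 * δ * Real.exp (l * t) ≤ ‖x t - y t‖} with hB
    have hBne : B.Nonempty := by
      obtain ⟨t, ht, h⟩ := hcon
      exact ⟨t, ht, h⟩
    have hBc : IsCompact B := by
      refine isCompact_Icc.of_isClosed_subset ?_ (sep_subset _ _)
      refine IsClosed.isClosed_le isClosed_Icc (by fun_prop) ?_
      exact ((hxc.mono fun s hs => by simp only [mem_Ici]; linarith [hs.1]).sub
        (hyc.mono fun s hs => by simp only [mem_Ici]; linarith [hs.1])).norm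
    obtain ⟨τ, ⟨hτ, hτB⟩, hmin⟩ := hBc.exists_isLeast hBne
    have hlt : ∀ s ∈ Ico (-r) τ, ‖x s - y s‖ ≤ 2 * δ * Real.exp (l * max s 0) := by
      intro s hs
      rcases le_total s 0 with h0 | h0
      · rw [max_eq_right h0, mul_zero, Real.exp_zero]
        linarith [hclose' s ⟨hs.1, h0⟩]
      · rw [max_eq_left h0]
        by_contra hc
        push Not at hc
        exact absurd (hmin ⟨⟨h0, hs.2.le.trans hτ.2⟩, hc.le⟩) (not_le.2 hs.2)
    have hder : ∀ s ∈ Ico 0 τ, ‖f (seg r x s) - f (seg r y s)‖ ≤ l * (2 * δ * Real.exp (l * s)) := by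
      intro s hs
      have h1 := (key s (2 * δ * Real.exp (l * s)) hs.1 (hs.2.le.trans hτ.2) ?_ (by positivity) ?_).1
      · refine h1.trans (mul_le_mul_of_nonneg_right (by linarith) (by positivity))
      · refine le_trans ?_ hδE
        exact mul_le_mul_of_nonneg_left (hexpE s (hs.2.le.trans hτ.2)) (by positivity)
      · intro u hu
        refine (hlt u ⟨hu.1, hu.2.trans_lt hs.2⟩).trans ?_
        refine mul_le_mul_of_nonneg_left (Real.exp_le_exp.2 ?_) (by positivity)
        exact mul_le_mul_of_nonneg_left (max_le hu.2 hs.1) hlpos.le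
    have hi1 := fseg_int hr hf hxc le_rfl hτ.1
    have hi2 := fseg_int hr hf hyc le_rfl hτ.1
    have hdiff : x τ - y τ = (x 0 - y 0) + ∫ s in (0:ℝ)..τ, (f (seg r x s) - f (seg r y s)) := by
      rw [intervalIntegral.integral_sub hi1 hi2, hx.2.2 τ hτ.1 ENNReal.ofReal_lt_top,
        hy.2.2 τ hτ.1 ENNReal.ofReal_lt_top]
      abel
    have hie : ∫ s in (0:ℝ)..τ, l * (2 * δ * Real.exp (l * s)) =
        2 * δ * Real.exp (l * τ) - 2 * δ * Real.exp (l * 0) := by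
      refine intervalIntegral.integral_eq_sub_of_hasDerivAt (f := fun s => 2 * δ * Real.exp (l * s))
        ?_ ?_
      · intro s _
        have := (((hasDerivAt_id s).const_mul l).exp).const_mul (2 * δ)
        refine this.congr_deriv ?_
        simp only [id, mul_one]
        ring
      · exact (by fun_prop : Continuous fun s => l * (2 * δ * Real.exp (l * s))).intervalIntegrable _ _
    have hn : ‖∫ s in (0:ℝ)..τ, (f (seg r x s) - f (seg r y s))‖ ≤
        ∫ s in (0:ℝ)..τ, l * (2 * δ * Real.exp (l * s)) := by
      refine intervalIntegral.norm_integral_le_of_norm_le hτ.1 ?_ ?_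
      · have hae : ∀ᵐ s ∂(volume : Measure ℝ), s ≠ τ := by
          simp [ae_iff]
        filter_upwards [hae] with s hs hs'
        exact hder s ⟨hs'.1.le, lt_of_le_of_ne hs'.2 hs⟩
      · exact (by fun_prop : Continuous fun s => l * (2 * δ * Real.exp (l * s))).intervalIntegrable _ _
    have h0 := hclose' 0 ⟨by linarith, le_rfl⟩
    rw [hdiff] at hτB
    have := norm_add_le (x 0 - y 0) (∫ s in (0:ℝ)..τ, (f (seg r x s) - f (seg r y s)))
    rw [hie] at hn
    simp only [mul_zero, Real.exp_zero, mul_one] at hn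
    linarith
  have hall : ∀ t ∈ Icc (-r) T, ‖x t - y t‖ ≤ 2 * δ * E := by
    intro t ht
    rcases le_total t 0 with h0 | h0
    · have h1 := hclose' t ⟨ht.1, h0⟩
      have h2 : 1 ≤ E := Real.one_le_exp (by positivity)
      nlinarith
    · refine (main t ⟨h0, ht.2⟩).le.trans ?_
      exact mul_le_mul_of_nonneg_left (hexpE t ht.2) (by positivity)
  have hall' : ∀ t ∈ Icc 0 T, ‖f (seg r x t) - f (seg r y t)‖ ≤ L M * (2 * δ * E) ∧
      supN r (seg r x t) ≤ M := fun t ht =>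
    key t (2 * δ * E) ht.1 ht.2 hδE (by positivity) fun s hs => hall s ⟨hs.1, hs.2.trans ht.2⟩
  have hδE0 : 0 ≤ 2 * δ * E := by positivity
  refine ⟨?_, ?_, ?_, ?_⟩
  · intro t ht
    have h1 := hM0 t ht
    have h2 := hall t ht
    have h3 := norm_le_norm_add_norm_sub (y t) (x t)
    rw [norm_sub_rev] at h3
    linarith
  · intro t ht
    have h1 := (hall' t ht).2
    have hz : supN r (0 : ℝ → Vec n) ≤ M := supN_le hMpos.le (by simp [hMpos.le])
    have h2 := hlip M _ _ (seg_memC0 hxc ht.1) (continuousOn_const (c := (0 : Vec n))) h1 hz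
    have h3 : f (fun _ => 0) = 0 := hf0
    rw [h3, sub_zero] at h2
    refine h2.trans (mul_le_mul_of_nonneg_left ?_ hLM)
    have h4 : (seg r x t - fun _ => (0 : Vec n)) = seg r x t := by
      ext1 s
      simp
    rw [h4]
    exact h1
  · intro t ht
    refine (hall t ht).trans ?_
    nlinarith
  · intro t ht
    refine (hall' t ht).1.trans ?_
    nlinarith

/-- The ball of radius `R` in the Hölder space, in elementary form. -/
def HB (r a R : ℝ) (g : ℝ → Vec n) : Prop :=
  MemC0 r g ∧ (∀ s ∈ Icc (-r) 0, ‖g s‖ ≤ R) ∧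
    ∀ s ∈ Icc (-r) 0, ∀ t ∈ Icc (-r) 0, ‖g s - g t‖ ≤ R * |s - t| ^ a

theorem HB.memHol {r a R : ℝ} {g : ℝ → Vec n} (h : HB r a R g) : MemHol r a g := by
  refine ⟨h.1, R, ?_⟩
  rintro _ ⟨t, ht, s, hs, hne, rfl⟩
  rw [div_le_iff₀ (Real.rpow_pos_of_pos (abs_pos.2 (sub_ne_zero.2 hne)) _)]
  exact h.2.2 t ht s hs

theorem HB.compact {r a R : ℝ} (hr : 0 < r) (ha : 0 < a) (g : ℕ → ℝ → Vec n)
    (hg : ∀ k, HB r a R (g k)) :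
    ∃ y0 : ℝ → Vec n, HB r a R y0 ∧ ∃ φ : ℕ → ℕ, StrictMono φ ∧
      ∀ δ : ℝ, 0 < δ → ∀ᶠ k in atTop, ∀ s ∈ Icc (-r) 0, ‖g (φ k) s - y0 s‖ ≤ δ := by
  have hr' : -r ≤ 0 := by linarith
  set A : Set (BoundedContinuousFunction (Icc (-r) 0) (Vec n)) :=
    {F | (∀ u, ‖F u‖ ≤ R) ∧ ∀ u v : Icc (-r) 0, ‖F u - F v‖ ≤ R * |(u:ℝ) - v| ^ a} with hA
  have hAc : IsCompact A := by
    refine BoundedContinuousFunction.arzela_ascoli₂ (Metric.closedBall 0 R)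
      (isCompact_closedBall _ _) A ?_ ?_ ?_
    · have e : A = (⋂ u : Icc (-r) 0, {F | ‖F u‖ ≤ R}) ∩
          ⋂ u : Icc (-r) 0, ⋂ v : Icc (-r) 0, {F | ‖F u - F v‖ ≤ R * |(u:ℝ) - v| ^ a} := by
        ext F
        simp only [hA, mem_ofPred_eq, mem_inter_iff, mem_iInter]
      rw [e]
      refine IsClosed.inter (isClosed_iInter fun u => ?_)
        (isClosed_iInter fun u => isClosed_iInter fun v => ?_)
      · exact isClosed_le (continuous_eval_const u).norm continuous_const
      · exact isClosed_le ((continuous_eval_const u).sub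
          (continuous_eval_const v)).norm continuous_const
    · intro F u hF
      simpa using hF.1 u
    · refine Metric.equicontinuous_of_continuity_modulus (fun d => R * |d| ^ a) ?_ _ ?_
      · have : Tendsto (fun d : ℝ => R * |d| ^ a) (𝓝 0) (𝓝 (R * |(0:ℝ)| ^ a)) := by
          refine Tendsto.const_mul _ ?_
          exact ((continuous_abs.rpow_const (fun x => Or.inr ha.le)).tendsto 0)
        simpa [Real.zero_rpow ha.ne'] using this
      · intro u v F
        rw [dist_eq_norm, Subtype.dist_eq, Real.dist_eq, abs_abs]
        exact F.2.2 u v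
  set F : ℕ → BoundedContinuousFunction (Icc (-r) 0) (Vec n) := fun k =>
    BoundedContinuousFunction.mkOfCompact ⟨(Icc (-r) 0).domRestrict (g k), (hg k).1.domRestrict⟩ with hF
  have hFA : ∀ k, F k ∈ A := fun k =>
    ⟨fun u => (hg k).2.1 u u.2, fun u v => (hg k).2.2 u u.2 v v.2⟩
  obtain ⟨y, hy, φ, hφ, hlim⟩ := hAc.tendsto_subseq hFA
  refine ⟨IccExtend hr' y, ⟨?_, ?_, ?_⟩, φ, hφ, ?_⟩
  · exact (y.continuous.Icc_extend').continuousOn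
  · intro s hs
    rw [IccExtend_of_mem hr' _ hs]
    exact hy.1 _
  · intro s hs t ht
    rw [IccExtend_of_mem hr' _ hs, IccExtend_of_mem hr' _ ht]
    exact hy.2 ⟨s, hs⟩ ⟨t, ht⟩
  · intro δ hδ
    rw [Metric.tendsto_atTop] at hlim
    obtain ⟨N, hN⟩ := hlim δ hδ
    filter_upwards [eventually_ge_atTop N] with k hk s hs
    have h1 := (BoundedContinuousFunction.dist_coe_le_dist (f := F (φ k)) (g := y) ⟨s, hs⟩).trans
      (hN k hk).le
    rw [dist_eq_norm] at h1
    rw [IccExtend_of_mem hr' _ hs]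
    exact h1

/-- The properties of the state space used in the abstract argument. -/
structure GoodX (r a : ℝ) (f : (ℝ → Vec n) → Vec n) (MemX : (ℝ → Vec n) → Prop)
    (NormX : (ℝ → Vec n) → ℝ) (c : ℝ) : Prop where
  cpos : 0 < c
  nonneg : ∀ g, 0 ≤ NormX g
  emb : ∀ g R, MemX g → NormX g ≤ R → HB r a R g
  mem : ∀ x0 x t, IsSol r f x0 x ⊤ → r ≤ t → MemX (seg r x t)
  bd : ∀ x0 x t R M K, MemX x0 → NormX x0 ≤ R → IsSol r f x0 x ⊤ → 0 ≤ t → 0 ≤ M → 0 ≤ K →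
    (∀ s ∈ Icc (-r) t, ‖x s‖ ≤ M) → (∀ s ∈ Icc 0 t, ‖f (seg r x s)‖ ≤ K) →
    NormX (seg r x t) ≤ R + M + c * K
  diff : ∀ x0 x y0 y t η, IsSol r f x0 x ⊤ → IsSol r f y0 y ⊤ → r ≤ t → 0 ≤ η →
    (∀ s ∈ Icc (-r) t, ‖x s - y s‖ ≤ η) →
    (∀ s ∈ Icc 0 t, ‖f (seg r x s) - f (seg r y s)‖ ≤ η) →
    NormX (seg r x t) ≤ NormX (seg r y t) + c * η

theorem abstract_main (r : ℝ) (hr : 0 < r)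
    (f : (ℝ → Vec n) → Vec n) (L : ℝ → ℝ) (hf : GoodRHS r f L)
    (a : ℝ) (ha : 0 < a)
    (hFC : ∀ x0 : ℝ → Vec n, MemHol r a x0 → ∃ x : ℝ → Vec n, IsSol r f x0 x ⊤)
    (MemX : (ℝ → Vec n) → Prop) (NormX : (ℝ → Vec n) → ℝ) (c : ℝ)
    (hX : GoodX r a f MemX NormX c) :
    ((∀ ε : ℝ, 0 < ε → ∃ δ : ℝ, 0 < δ ∧ ∀ x0 x : ℝ → Vec n, MemX x0 →
        IsSol r f x0 x ⊤ → NormX x0 ≤ δ → ∀ t : ℝ, 0 ≤ t → NormX (seg r x t) ≤ ε) ∧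
     (∀ x0 x : ℝ → Vec n, MemX x0 → IsSol r f x0 x ⊤ →
        Tendsto (fun t => NormX (seg r x t)) atTop (nhds 0)))
    ↔
    (∃ σ : ℝ → ℝ → ℝ, ClassKL σ ∧ ∀ x0 x : ℝ → Vec n, MemX x0 →
        IsSol r f x0 x ⊤ → ∀ t : ℝ, 0 ≤ t → NormX (seg r x t) ≤ σ (NormX x0) t) := by
  have hc := hX.cpos
  constructor
  · rintro ⟨hstab, hattr⟩
    -- local uniformity
    have hloc : ∀ R ε : ℝ, 0 < ε → ∀ y0, HB r a R y0 → ∃ N δ1 : ℝ, 0 < δ1 ∧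
        ∀ x0 x, MemX x0 → NormX x0 ≤ R → IsSol r f x0 x ⊤ →
          (∀ s ∈ Icc (-r) 0, ‖x0 s - y0 s‖ ≤ δ1) →
          (∀ t, N ≤ t → 0 ≤ t → NormX (seg r x t) ≤ ε) ∧ (∀ t, 0 ≤ t → NormX (seg r x t) ≤ N) := by
      intro R ε hε y0 hy0
      obtain ⟨y, hy⟩ := hFC y0 hy0.memHol
      obtain ⟨δ, hδ, hst⟩ := hstab ε hε
      have hat := hattr _ _ (hX.mem _ _ r hy le_rfl) (sol_shift hr hf hy hr.le)
      obtain ⟨T1, hT1, hT1'⟩ := (((hat.eventually (ge_mem_nhds (half_pos hδ))).and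
        (eventually_ge_atTop 0))).exists
      rw [seg_seg] at hT1
      set T := r + T1 with hT
      have hT0 : 0 ≤ T := by linarith
      obtain ⟨M, C, δ0, hM, hC, hδ0, hdep⟩ := cont_dep hr hf hy hT0
      set K := L M * M with hK
      have hK0 : 0 ≤ K := mul_nonneg (hf.2.2.2.1 M) hM
      refine ⟨max T (max ε (R + M + c * K)), min δ0 (δ / 2 / (c * C)), by positivity, ?_⟩
      intro x0 x hx0 hxR hx hcl
      obtain ⟨d1, d2, d3, d4⟩ := hdep _ x0 x (by positivity) (min_le_left _ _) hx hcl
      set δ1 := min δ0 (δ / 2 / (c * C)) with hδ1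
      have hCδ : c * (C * δ1) ≤ δ / 2 := by
        have : δ1 ≤ δ / 2 / (c * C) := min_le_right _ _
        rw [le_div_iff₀ (by positivity)] at this
        linarith
      have hδ1p : 0 < δ1 := by positivity
      have h1 : NormX (seg r x T) ≤ δ := by
        have := hX.diff x0 x y0 y T (C * δ1) hx hy (by linarith) (by positivity) d3 d4
        linarith
      have h2 : ∀ t, T ≤ t → NormX (seg r x t) ≤ ε := by
        intro t ht
        have := hst _ _ (hX.mem _ _ T hx (by linarith)) (sol_shift hr hf hx hT0) h1 (t - T)
          (by linarith)
        rwa [seg_seg, add_sub_cancel] at this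
      refine ⟨fun t ht _ => h2 t ((le_max_left _ _).trans ht), fun t ht => ?_⟩
      rcases le_total T t with h | h
      · exact (h2 t h).trans ((le_max_left _ _).trans (le_max_right _ _))
      · refine (hX.bd x0 x t R M K hx0 hxR hx ht hM hK0 ?_ ?_).trans
          ((le_max_right _ _).trans (le_max_right _ _))
        · exact fun s hs => d1 s ⟨hs.1, hs.2.trans h⟩
        · exact fun s hs => d2 s ⟨hs.1, hs.2.trans h⟩
    -- global uniformity by compactness
    have hglob : ∀ R ε : ℝ, 0 < ε → ∃ N : ℝ,
        ∀ x0 x, MemX x0 → NormX x0 ≤ R → IsSol r f x0 x ⊤ →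
          (∀ t, N ≤ t → 0 ≤ t → NormX (seg r x t) ≤ ε) ∧ (∀ t, 0 ≤ t → NormX (seg r x t) ≤ N) := by
      intro R ε hε
      by_contra hcon
      have hcon' : ∀ k : ℕ, ∃ x0 x, MemX x0 ∧ NormX x0 ≤ R ∧ IsSol r f x0 x ⊤ ∧
          ¬ ((∀ t, (k:ℝ) ≤ t → 0 ≤ t → NormX (seg r x t) ≤ ε) ∧
            (∀ t, 0 ≤ t → NormX (seg r x t) ≤ k)) := by
        intro k
        by_contra h
        refine hcon ⟨k, fun x0 x h1 h2 h3 => ?_⟩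
        by_contra h4
        exact h ⟨x0, x, h1, h2, h3, h4⟩
      choose x0 x hm hR hs hbad using hcon'
      obtain ⟨y0, hy0, φ, hφ, hlim⟩ := HB.compact hr ha x0 (fun k => hX.emb _ _ (hm k) (hR k))
      obtain ⟨N, δ1, hδ1, hN⟩ := hloc R ε hε y0 hy0
      obtain ⟨k, hk1, hk2⟩ := ((hlim δ1 hδ1).and
        (eventually_ge_atTop ⌈N⌉₊)).exists
      have hNk : N ≤ (φ k : ℝ) := by
        refine (Nat.le_ceil N).trans ?_
        exact_mod_cast hk2.trans (hφ.id_le k)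
      obtain ⟨g1, g2⟩ := hN _ _ (hm (φ k)) (hR (φ k)) (hs (φ k)) hk1
      exact hbad (φ k) ⟨fun t ht h0 => g1 t (hNk.trans ht) h0, fun t h0 => (g2 t h0).trans hNk⟩
    set S : ℝ → ℝ → ℝ → Prop := fun s t v => 0 ≤ t ∧ ∃ x0 x, MemX x0 ∧ IsSol r f x0 x ⊤ ∧
        NormX x0 = s ∧ NormX (seg r x t) = v with hS
    have k1 : ∀ ε : ℝ, 0 < ε → ∃ δ : ℝ, 0 < δ ∧ ∀ s t v, S s t v → s ≤ δ → v ≤ ε := by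
      intro ε hε
      obtain ⟨δ, hδ, h⟩ := hstab ε hε
      refine ⟨δ, hδ, ?_⟩
      rintro s t v ⟨ht, x0, x, h1, h2, rfl, rfl⟩ hs
      exact h x0 x h1 h2 hs t ht
    have k2 : ∀ R ε : ℝ, 0 < ε → ∃ N : ℝ, ∀ s t v, S s t v → s ≤ R →
        (N ≤ t → v ≤ ε) ∧ v ≤ N := by
      intro R ε hε
      obtain ⟨N, hN⟩ := hglob R ε hε
      refine ⟨N, ?_⟩
      rintro s t v ⟨ht, x0, x, h1, h2, rfl, rfl⟩ hs
      obtain ⟨g1, g2⟩ := hN x0 x h1 hs h2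
      exact ⟨fun h => g1 t h ht, g2 t ht⟩
    obtain ⟨σ, hσ, hσ'⟩ := exists_KL S k1 k2
    exact ⟨σ, hσ, fun x0 x h1 h2 t ht =>
      hσ' _ _ _ (hX.nonneg _) ht ⟨ht, x0, x, h1, h2, rfl, rfl⟩⟩
  · rintro ⟨σ, ⟨hσ1, hσ2, hσ3⟩, h⟩
    refine ⟨?_, ?_⟩
    · intro ε hε
      obtain ⟨hc0, hmono, hz⟩ := hσ2 0 le_rfl
      have := hc0 0 self_mem_Ici
      rw [Metric.continuousWithinAt_iff] at this
      obtain ⟨δ, hδ, hd⟩ := this ε hε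
      refine ⟨δ / 2, by linarith, ?_⟩
      intro x0 x h1 h2 h3 t ht
      have h0 := hX.nonneg x0
      have h4 := hd (x := NormX x0) h0 (by
        rw [Real.dist_eq, sub_zero, abs_of_nonneg h0]; linarith)
      rw [Real.dist_eq, hz, sub_zero] at h4
      have h5 := (hσ3 (NormX x0) h0).1 (mem_Ici.2 le_rfl) (mem_Ici.2 ht) ht
      exact ((h x0 x h1 h2 t ht).trans h5).trans ((le_abs_self _).trans h4.le)
    · intro x0 x h1 h2
      refine tendsto_of_tendsto_of_tendsto_of_le_of_le' tendsto_const_nhds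
        (hσ3 (NormX x0) (hX.nonneg x0)).2 (Eventually.of_forall fun t => hX.nonneg _) ?_
      filter_upwards [eventually_ge_atTop 0] with t ht
      exact h x0 x h1 h2 t ht

theorem hexp_pos {p : ℝ≥0∞} (hp : 1 < p) : 0 < hexp p := by
  unfold hexp
  rcases eq_or_ne p ⊤ with rfl | h
  · simp
  · have : 1 < p.toReal := by
      rw [← ENNReal.toReal_one]
      exact (ENNReal.toReal_lt_toReal ENNReal.one_ne_top h).2 hp
    linarith [inv_lt_one_of_one_lt₀ this]

theorem abs_le_rpow {r a d : ℝ} (ha1 : a ≤ 1) (hd : 0 ≤ d) (hdr : d ≤ r) :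
    d ≤ r ^ (1 - a) * d ^ a := by
  rcases hd.eq_or_lt with rfl | h
  · have : 0 ≤ r := hdr
    positivity
  · calc d = d ^ (1 - a) * d ^ a := by rw [← Real.rpow_add h]; simp
      _ ≤ r ^ (1 - a) * d ^ a := by
        refine mul_le_mul_of_nonneg_right ?_ (by positivity)
        exact Real.rpow_le_rpow hd hdr (by linarith)

theorem sol_diff_lip {r : ℝ} (hr : 0 < r) {f : (ℝ → Vec n) → Vec n} {L : ℝ → ℝ}
    (hf : GoodRHS r f L) {x0 x y0 y : ℝ → Vec n} (hx : IsSol r f x0 x ⊤) (hy : IsSol r f y0 y ⊤)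
    {T K : ℝ} (hK : ∀ s ∈ Icc 0 T, ‖f (seg r x s) - f (seg r y s)‖ ≤ K) {a b : ℝ}
    (ha : a ∈ Icc 0 T) (hb : b ∈ Icc 0 T) :
    ‖(x a - x b) - (y a - y b)‖ ≤ K * |a - b| := by
  rw [sol_sub hr hf hx hb.1 ha.1, sol_sub hr hf hy hb.1 ha.1, ← intervalIntegral.integral_sub
    (fseg_int hr hf (sol_cont hx) hb.1 ha.1) (fseg_int hr hf (sol_cont hy) hb.1 ha.1)]
  refine intervalIntegral.norm_integral_le_of_norm_le_const ?_
  intro s hs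
  exact hK s (uIcc_subset_Icc hb ha (uIoc_subset_uIcc hs))

theorem holderNorm_le {r a C : ℝ} {g : ℝ → Vec n} (hC : 0 ≤ C)
    (h1 : ∀ s ∈ Icc (-r) 0, ‖g s‖ ≤ C)
    (h2 : ∀ s ∈ Icc (-r) 0, ∀ t ∈ Icc (-r) 0, ‖g s - g t‖ ≤ C * |s - t| ^ a) :
    holderNorm r a g ≤ C := by
  refine max_le (supN_le hC h1) (Real.sSup_le ?_ hC)
  rintro _ ⟨t, ht, s, hs, hne, rfl⟩
  rw [div_le_iff₀ (Real.rpow_pos_of_pos (abs_pos.2 (sub_ne_zero.2 hne)) _)]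
  exact h2 t ht s hs

theorem holderNorm_nonneg (r a : ℝ) (g : ℝ → Vec n) : 0 ≤ holderNorm r a g :=
  (supN_nonneg r g).trans (le_max_left _ _)

theorem hol_emb {r a : ℝ} {g : ℝ → Vec n} {R : ℝ} (hg : MemHol r a g)
    (hR : holderNorm r a g ≤ R) : HB r a R g := by
  have hR0 := (holderNorm_nonneg r a g).trans hR
  refine ⟨hg.1, fun s hs => (le_supN hg.1 hs).trans ((le_max_left _ _).trans hR), ?_⟩
  intro s hs t ht
  rcases eq_or_ne s t with rfl | hne
  · simp only [sub_self, norm_zero]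
    positivity
  · rw [← div_le_iff₀ (Real.rpow_pos_of_pos (abs_pos.2 (sub_ne_zero.2 hne)) _)]
    exact (le_csSup hg.2 ⟨s, hs, t, ht, hne, rfl⟩).trans ((le_max_right _ _).trans hR)

theorem goodX_hol {r : ℝ} (hr : 0 < r) {f : (ℝ → Vec n) → Vec n} {L : ℝ → ℝ}
    (hf : GoodRHS r f L) {a : ℝ} (ha : 0 < a) (ha1 : a ≤ 1) :
    GoodX r a f (MemHol r a) (holderNorm r a) (1 + r ^ (1 - a)) := by
  have hrp : 0 < r ^ (1 - a) := Real.rpow_pos_of_pos hr _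
  have hd : ∀ s ∈ Icc (-r) 0, ∀ t ∈ Icc (-r) 0, |s - t| ≤ r ^ (1 - a) * |s - t| ^ a := by
    intro s hs t ht
    refine abs_le_rpow ha1 (abs_nonneg _) ?_
    rw [abs_le]
    exact ⟨by linarith [hs.1, ht.2], by linarith [hs.2, ht.1]⟩
  have hmem : ∀ x0 x t, IsSol r f x0 x ⊤ → r ≤ t → MemHol r a (seg r x t) := by
    intro x0 x t hx ht
    have ht0 : 0 ≤ t := by linarith
    obtain ⟨K, hK0, hK⟩ := fseg_bound hr hf (sol_cont hx) t
    have hC := seg_memC0 (sol_cont hx) ht0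
    refine HB.memHol (R := supN r (seg r x t) + K * r ^ (1 - a)) ⟨hC, fun s hs =>
      (le_supN hC hs).trans (le_add_of_nonneg_right (by positivity)), ?_⟩
    intro u hu v hv
    have h1 := sol_lip hr hf hx hK (a := t + u) (b := t + v)
      ⟨by linarith [hu.1], by linarith [hu.2]⟩ ⟨by linarith [hv.1], by linarith [hv.2]⟩
    have h2 := mul_le_mul_of_nonneg_left (hd u hu v hv) hK0
    rw [add_sub_add_left_eq_sub] at h1
    have h3 : 0 ≤ supN r (seg r x t) * |u - v| ^ a := mul_nonneg (supN_nonneg _ _) (by positivity)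
    simp only [seg] at h3 ⊢
    nlinarith
  refine ⟨by positivity, holderNorm_nonneg r a, fun g R => hol_emb, hmem, ?_, ?_⟩
  · intro x0 x t R M K hx0 hR hx ht hM hK0 hxM hK
    have hR0 := (holderNorm_nonneg r a x0).trans hR
    have hB := hol_emb hx0 hR
    have hcK : 0 ≤ r ^ (1 - a) * K := by positivity
    refine holderNorm_le (by positivity) ?_ ?_
    · intro s hs
      refine (hxM (t + s) ⟨by linarith [hs.1], by linarith [hs.2]⟩).trans ?_
      nlinarith
    · intro u hu v hv
      have hsplit : x (t + u) - x (t + v) = (x (min (t + u) 0) - x (min (t + v) 0)) +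
          (x (max (t + u) 0) - x (max (t + v) 0)) := by
        rcases le_total (t + u) 0 with h1 | h1 <;> rcases le_total (t + v) 0 with h2 | h2 <;>
          simp [h1, h2]
      have m1 : min (t + u) 0 ∈ Icc (-r) 0 :=
        ⟨le_min (by linarith [hu.1]) (by linarith), min_le_right _ _⟩
      have m2 : min (t + v) 0 ∈ Icc (-r) 0 :=
        ⟨le_min (by linarith [hv.1]) (by linarith), min_le_right _ _⟩
      have m3 : max (t + u) 0 ∈ Icc 0 t := ⟨le_max_right _ _, max_le (by linarith [hu.2]) ht⟩
      have m4 : max (t + v) 0 ∈ Icc 0 t := ⟨le_max_right _ _, max_le (by linarith [hv.2]) ht⟩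
      have h1 : ‖x (min (t + u) 0) - x (min (t + v) 0)‖ ≤ R * |u - v| ^ a := by
        rw [hx.2.1 m1, hx.2.1 m2]
        refine (hB.2.2 _ m1 _ m2).trans (mul_le_mul_of_nonneg_left ?_ hR0)
        refine Real.rpow_le_rpow (abs_nonneg _) ?_ ha.le
        have := abs_min_sub_min_le_max (t + u) 0 (t + v) 0
        simpa using this
      have h2 : ‖x (max (t + u) 0) - x (max (t + v) 0)‖ ≤ K * (r ^ (1 - a) * |u - v| ^ a) := by
        refine (sol_lip hr hf hx hK m3 m4).trans (mul_le_mul_of_nonneg_left ?_ hK0)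
        refine le_trans ?_ (hd u hu v hv)
        have := abs_max_sub_max_le_max (t + u) 0 (t + v) 0
        simpa using this
      simp only [seg]
      rw [hsplit]
      have h3 := norm_add_le (x (min (t + u) 0) - x (min (t + v) 0))
        (x (max (t + u) 0) - x (max (t + v) 0))
      have h4 : 0 ≤ (M + K) * |u - v| ^ a := by positivity
      nlinarith
  · intro x0 x y0 y t η hx hy ht hη hcl hcf
    have ht0 : 0 ≤ t := by linarith
    have hN := holderNorm_nonneg r a (seg r y t)
    have hB := hol_emb (hmem y0 y t hy ht) le_rfl
    have hcη : 0 ≤ r ^ (1 - a) * η := by positivity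
    refine holderNorm_le (by positivity) ?_ ?_
    · intro s hs
      have h1 := hcl (t + s) ⟨by linarith [hs.1], by linarith [hs.2]⟩
      have h2 := hB.2.1 s hs
      have h3 := norm_le_norm_add_norm_sub (y (t + s)) (x (t + s))
      rw [norm_sub_rev] at h3
      simp only [seg] at h2 ⊢
      nlinarith
    · intro u hu v hv
      have h1 := sol_diff_lip hr hf hx hy hcf (a := t + u) (b := t + v)
        ⟨by linarith [hu.1], by linarith [hu.2]⟩ ⟨by linarith [hv.1], by linarith [hv.2]⟩
      rw [add_sub_add_left_eq_sub] at h1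
      have h2 := hB.2.2 u hu v hv
      have h3 := mul_le_mul_of_nonneg_left (hd u hu v hv) hη
      have h4 := norm_le_norm_add_norm_sub (y (t + u) - y (t + v)) (x (t + u) - x (t + v))
      rw [norm_sub_rev (y (t + u) - y (t + v)) (x (t + u) - x (t + v))] at h4
      have h5 : 0 ≤ η * |u - v| ^ a := by positivity
      simp only [seg] at h2 ⊢
      nlinarith

theorem sobNorm_nonneg (r : ℝ) (p : ℝ≥0∞) (g : ℝ → Vec n) : 0 ≤ sobNorm r p g :=
  add_nonneg (supN_nonneg r g) ENNReal.toReal_nonneg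

theorem MemW.props {r : ℝ} (hr : 0 < r) {p : ℝ≥0∞} {g : ℝ → Vec n} (hg : MemW r p g) :
    ∃ d : ℝ → Vec n, IntegrableOn d (Icc (-r) 0) ∧ MemC0 r g ∧
      (∀ s ∈ Icc (-r) 0, ∀ t ∈ Icc (-r) 0, g t - g s = ∫ u in s..t, d u) ∧
      eLpNorm (deriv g) p (volume.restrict (Ioo (-r) 0)) =
        eLpNorm d p (volume.restrict (Ioo (-r) 0)) ∧
      eLpNorm (deriv g) p (volume.restrict (Ioo (-r) 0)) ≠ ⊤ := by
  obtain ⟨d, hd, hlp, hint⟩ := hg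
  have hr' : -r ≤ 0 := by linarith
  have hii : IntervalIntegrable d volume (-r) 0 := by
    rw [intervalIntegrable_iff_integrableOn_Icc_of_le hr']
    exact hd
  have hii' : ∀ s ∈ Icc (-r) 0, ∀ t ∈ Icc (-r) 0, IntervalIntegrable d volume s t := by
    intro s hs t ht
    refine hii.mono_set ?_
    rw [uIcc_of_le hr']
    exact uIcc_subset_Icc hs ht
  have hl : -r ∈ Icc (-r) 0 := ⟨le_rfl, hr'⟩
  have hae : ∀ᵐ s ∂(volume.restrict (Ioo (-r) 0)), deriv g s = d s := by
    rw [ae_restrict_iff' measurableSet_Ioo]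
    filter_upwards [hii.ae_hasDerivAt_integral] with s hs hs'
    have h1 := hs (by rw [uIcc_of_le hr']; exact Ioo_subset_Icc_self hs') (-r) left_mem_uIcc
    have h2 : HasDerivAt g (d s) s := by
      refine (h1.const_add (g (-r))).congr_of_eventuallyEq ?_
      filter_upwards [Ioo_mem_nhds hs'.1 hs'.2] with u hu
      exact hint u (Ioo_subset_Icc_self hu)
    exact h2.deriv
  have heq := eLpNorm_congr_ae (p := p) hae
  refine ⟨d, hd, ?_, ?_, heq, ?_⟩
  · have hc : ContinuousOn (fun t => g (-r) + ∫ s in (-r)..t, d s) (Icc (-r) 0) := by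
      refine continuousOn_const.add ?_
      have := intervalIntegral.continuousOn_primitive_interval (μ := volume) (f := d) (a := -r)
        (b := 0) (by rw [uIcc_of_le hr']; exact hd)
      rwa [uIcc_of_le hr'] at this
    exact hc.congr fun t ht => hint t ht
  · intro s hs t ht
    rw [hint s hs, hint t ht, ← intervalIntegral.integral_interval_sub_left
      (hii' _ hl _ ht) (hii' _ hl _ hs)]
    abel
  · rw [heq]
    exact hlp.ne

theorem sob_emb {r : ℝ} (hr : 0 < r) {p : ℝ≥0∞} (hp : 1 < p) {g : ℝ → Vec n} {R : ℝ}
    (hg : MemW r p g) (hR : sobNorm r p g ≤ R) : HB r (hexp p) R g := by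
  obtain ⟨d, hd, hC, hsub, heq, htop⟩ := hg.props hr
  have hsn := supN_nonneg r g
  have htn : 0 ≤ (eLpNorm (deriv g) p (volume.restrict (Ioo (-r) 0))).toReal :=
    ENNReal.toReal_nonneg
  unfold sobNorm at hR
  refine ⟨hC, fun s hs => (le_supN hC hs).trans (by linarith), ?_⟩
  have key : ∀ s ∈ Icc (-r) 0, ∀ t ∈ Icc (-r) 0, s ≤ t → ‖g t - g s‖ ≤ R * |t - s| ^ hexp p := by
    intro s hs t ht hst
    have hsubset : Ioc s t ⊆ Icc (-r) 0 := fun u hu => ⟨hs.1.trans hu.1.le, hu.2.trans ht.2⟩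
    have h1 : ‖g t - g s‖ₑ ≤ eLpNorm (deriv g) p (volume.restrict (Ioo (-r) 0)) *
        ENNReal.ofReal (t - s) ^ hexp p := by
      rw [hsub s hs t ht, intervalIntegral.integral_of_le hst]
      refine (enorm_integral_le_lintegral_enorm _).trans ?_
      rw [← eLpNorm_one_eq_lintegral_enorm]
      refine (eLpNorm_le_eLpNorm_mul_rpow_measure_univ hp.le
        (hd.mono_set hsubset).aestronglyMeasurable).trans ?_
      rw [heq, Measure.restrict_congr_set (Ioo_ae_eq_Icc (a := -r) (b := 0))]
      refine mul_le_mul' (eLpNorm_mono_measure _ (Measure.restrict_mono hsubset le_rfl)) ?_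
      simp [hexp]
    have h2 := ENNReal.toReal_mono (ENNReal.mul_ne_top htop
      (ENNReal.rpow_ne_top_of_nonneg (hexp_pos hp).le ENNReal.ofReal_ne_top)) h1
    rw [toReal_enorm, ENNReal.toReal_mul, ← ENNReal.toReal_rpow,
      ENNReal.toReal_ofReal (by linarith)] at h2
    rw [abs_of_nonneg (by linarith : 0 ≤ t - s)]
    refine h2.trans (mul_le_mul_of_nonneg_right (by linarith) ?_)
    exact Real.rpow_nonneg (by linarith) _
  intro s hs t ht
  rcases le_total s t with h | h
  · rw [norm_sub_rev, abs_sub_comm]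
    exact key s hs t ht h
  · exact key t ht s hs h

theorem eLpNorm_const_bound {r : ℝ} (hr : 0 < r) {p : ℝ≥0∞} {g : ℝ → Vec n} {K : ℝ}
    (h : ∀ᵐ s ∂(volume.restrict (Ioo (-r) 0)), ‖g s‖ ≤ K) :
    eLpNorm g p (volume.restrict (Ioo (-r) 0)) ≤ ENNReal.ofReal (r ^ (p.toReal⁻¹) * K) := by
  refine (eLpNorm_le_of_ae_bound h).trans (le_of_eq ?_)
  rw [ENNReal.ofReal_mul (by positivity), Measure.restrict_apply_univ, Real.volume_Ioo,
    ENNReal.ofReal_rpow_of_nonneg (by linarith) (by positivity)]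
  simp

theorem goodX_sob {r : ℝ} (hr : 0 < r) {f : (ℝ → Vec n) → Vec n} {L : ℝ → ℝ}
    (hf : GoodRHS r f L) {p : ℝ≥0∞} (hp : 1 < p) :
    GoodX r (hexp p) f (MemW r p) (sobNorm r p) (1 + r ^ (p.toReal⁻¹)) := by
  have hr' : -r ≤ 0 := by linarith
  have hrp : 0 < r ^ (p.toReal⁻¹) := Real.rpow_pos_of_pos hr _
  have hder : ∀ (x : ℝ → Vec n) t s, deriv (seg r x t) s = deriv x (t + s) := fun x t s =>
    deriv_comp_const_add _ _ _
  have hmem : ∀ x0 x t, IsSol r f x0 x ⊤ → r ≤ t → MemW r p (seg r x t) := by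
    intro x0 x t hx ht
    have ht0 : 0 ≤ t := by linarith
    obtain ⟨K, hK0, hK⟩ := fseg_bound hr hf (sol_cont hx) t
    refine ⟨fun s => f (seg r x (t + s)), ?_, ?_, ?_⟩
    · refine ContinuousOn.integrableOn_Icc ?_
      refine (fseg_cont hr hf (sol_cont hx)).comp (by fun_prop) ?_
      intro s hs
      simp only [mem_Ici]
      linarith [hs.1]
    · refine (eLpNorm_const_bound hr (K := K) ?_).trans_lt ENNReal.ofReal_lt_top
      rw [ae_restrict_iff' measurableSet_Ioo]
      exact Eventually.of_forall fun s hs => hK _ ⟨by linarith [hs.1], by linarith [hs.2]⟩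
    · intro s hs
      have h1 := sol_sub hr hf hx (a := t + -r) (b := t + s) (by linarith) (by linarith [hs.1])
      have h2 := intervalIntegral.integral_comp_add_left (fun s => f (seg r x s)) t
        (a := -r) (b := s)
      simp only [seg] at h1 h2 ⊢
      rw [h2, ← h1]
      abel
  refine ⟨by positivity, sobNorm_nonneg r p, fun g R => sob_emb hr hp, hmem, ?_, ?_⟩
  · intro x0 x t R M K hx0 hR hx ht hM hK0 hxM hK
    obtain ⟨-, -, -, -, -, htop⟩ := hx0.props hr
    have hs0 := supN_nonneg r x0
    set E := eLpNorm (deriv x0) p (volume.restrict (Ioo (-r) 0)) with hE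
    have hsup : supN r (seg r x t) ≤ M :=
      supN_le hM fun s hs => hxM _ ⟨by linarith [hs.1], by linarith [hs.2]⟩
    set G : ℝ → Vec n := (Ioo (-r) 0).indicator (deriv x0) with hG
    have hGm : StronglyMeasurable G := (stronglyMeasurable_deriv x0).indicator measurableSet_Ioo
    set G' : ℝ → Vec n := G ∘ (fun s => t + s) with hG'
    have hG'm : StronglyMeasurable G' := hGm.comp_measurable (measurable_const_add t)
    set H : ℝ → Vec n := deriv (seg r x t) - G' with hH
    have hHm : StronglyMeasurable H := (stronglyMeasurable_deriv _).sub hG'm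
    have hHb : eLpNorm H p (volume.restrict (Ioo (-r) 0)) ≤
        ENNReal.ofReal (r ^ (p.toReal⁻¹) * K) := by
      refine eLpNorm_const_bound hr ?_
      rw [ae_restrict_iff' measurableSet_Ioo]
      have hae : ∀ᵐ s ∂(volume : Measure ℝ), s ≠ -t := by simp [ae_iff]
      filter_upwards [hae] with s hs hs'
      simp only [hH, hG', hG, Pi.sub_apply, Function.comp, hder]
      rcases lt_trichotomy (t + s) 0 with h | h | h
      · have hm : t + s ∈ Ioo (-r) 0 := ⟨by linarith [hs'.1], h⟩
        rw [indicator_of_mem hm]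
        have : deriv x (t + s) = deriv x0 (t + s) := by
          refine Filter.EventuallyEq.deriv_eq ?_
          filter_upwards [Ioo_mem_nhds hm.1 hm.2] with u hu
          exact hx.2.1 (Ioo_subset_Icc_self hu)
        rw [this, sub_self, norm_zero]
        exact hK0
      · exact absurd (by linarith) hs
      · have hm : t + s ∉ Ioo (-r) 0 := fun hm => absurd hm.2 (not_lt.2 h.le)
        rw [indicator_of_notMem hm, sub_zero, (sol_deriv hr hf hx h).deriv]
        exact hK _ ⟨h.le, by linarith [hs'.2]⟩
    have hGb : eLpNorm G' p (volume.restrict (Ioo (-r) 0)) ≤ E := by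
      refine (eLpNorm_mono_measure _ Measure.restrict_le_self).trans ?_
      rw [hG', eLpNorm_comp_measurePreserving hGm.aestronglyMeasurable
        (measurePreserving_add_left volume t), hG,
        eLpNorm_indicator_eq_eLpNorm_restrict measurableSet_Ioo]
    have htot : eLpNorm (deriv (seg r x t)) p (volume.restrict (Ioo (-r) 0)) ≤
        E + ENNReal.ofReal (r ^ (p.toReal⁻¹) * K) := by
      have e : deriv (seg r x t) = G' + H := by simp [hH]
      rw [e]
      exact (eLpNorm_add_le hG'm.aestronglyMeasurable hHm.aestronglyMeasurable hp.le).trans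
        (add_le_add hGb hHb)
    have h2 := ENNReal.toReal_mono (ENNReal.add_ne_top.2 ⟨htop, ENNReal.ofReal_ne_top⟩) htot
    rw [ENNReal.toReal_add htop ENNReal.ofReal_ne_top,
      ENNReal.toReal_ofReal (by positivity)] at h2
    unfold sobNorm at hR ⊢
    nlinarith
  · intro x0 x y0 y t η hx hy ht hη hcl hcf
    have ht0 : 0 ≤ t := by linarith
    obtain ⟨-, -, hyC, -, -, htop⟩ := (hmem y0 y t hy ht).props hr
    set E := eLpNorm (deriv (seg r y t)) p (volume.restrict (Ioo (-r) 0)) with hE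
    have hsup : supN r (seg r x t) ≤ supN r (seg r y t) + η := by
      refine supN_le (add_nonneg (supN_nonneg _ _) hη) fun s hs => ?_
      have h1 := hcl (t + s) ⟨by linarith [hs.1], by linarith [hs.2]⟩
      have h2 := le_supN hyC hs
      have h3 := norm_le_norm_add_norm_sub (y (t + s)) (x (t + s))
      rw [norm_sub_rev] at h3
      simp only [seg] at h2 ⊢
      linarith
    set H : ℝ → Vec n := deriv (seg r x t) - deriv (seg r y t) with hH
    have hHm : StronglyMeasurable H :=
      (stronglyMeasurable_deriv _).sub (stronglyMeasurable_deriv _)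
    have hHb : eLpNorm H p (volume.restrict (Ioo (-r) 0)) ≤
        ENNReal.ofReal (r ^ (p.toReal⁻¹) * η) := by
      refine eLpNorm_const_bound hr ?_
      rw [ae_restrict_iff' measurableSet_Ioo]
      refine Eventually.of_forall fun s hs => ?_
      have h0 : 0 < t + s := by linarith [hs.1]
      simp only [hH, Pi.sub_apply, hder]
      rw [(sol_deriv hr hf hx h0).deriv, (sol_deriv hr hf hy h0).deriv]
      exact hcf _ ⟨h0.le, by linarith [hs.2]⟩
    have htot : eLpNorm (deriv (seg r x t)) p (volume.restrict (Ioo (-r) 0)) ≤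
        E + ENNReal.ofReal (r ^ (p.toReal⁻¹) * η) := by
      have e : deriv (seg r x t) = deriv (seg r y t) + H := by simp [hH]
      rw [e]
      exact (eLpNorm_add_le (stronglyMeasurable_deriv _).aestronglyMeasurable
        hHm.aestronglyMeasurable hp.le).trans (add_le_add le_rfl hHb)
    have h2 := ENNReal.toReal_mono (ENNReal.add_ne_top.2 ⟨htop, ENNReal.ofReal_ne_top⟩) htot
    rw [ENNReal.toReal_add htop ENNReal.ofReal_ne_top,
      ENNReal.toReal_ofReal (by positivity)] at h2
    unfold sobNorm
    nlinarith

/-- If the system is forward complete from Hölder `C^{0,1-1/p}`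
initial data, then for the state space `X = W^{1,p}` or `X = C^{0,1-1/p}`
(`p ∈ (1,∞]`), GAS in `X` (Lyapunov stability ∧ global attractivity) ↔ UGAS in `X`. -/
theorem stmt3 (n : ℕ) (hn : 1 ≤ n) (r : ℝ) (hr : 0 < r)
    (f : (ℝ → Vec n) → Vec n) (L : ℝ → ℝ) (hf : GoodRHS r f L)
    (p : ℝ≥0∞) (hp : 1 < p)
    (hFC : ∀ x0 : ℝ → Vec n, MemHol r (hexp p) x0 → ∃ x : ℝ → Vec n, IsSol r f x0 x ⊤)
    (MemX : (ℝ → Vec n) → Prop) (NormX : (ℝ → Vec n) → ℝ)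
    (hX : (MemX = MemW r p ∧ NormX = sobNorm r p) ∨
          (MemX = MemHol r (hexp p) ∧ NormX = holderNorm r (hexp p))) :
    ((∀ ε : ℝ, 0 < ε → ∃ δ : ℝ, 0 < δ ∧ ∀ x0 x : ℝ → Vec n, MemX x0 →
        IsSol r f x0 x ⊤ → NormX x0 ≤ δ → ∀ t : ℝ, 0 ≤ t → NormX (seg r x t) ≤ ε) ∧
     (∀ x0 x : ℝ → Vec n, MemX x0 → IsSol r f x0 x ⊤ →
        Tendsto (fun t => NormX (seg r x t)) atTop (nhds 0)))
    ↔
    (∃ σ : ℝ → ℝ → ℝ, ClassKL σ ∧ ∀ x0 x : ℝ → Vec n, MemX x0 →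
        IsSol r f x0 x ⊤ → ∀ t : ℝ, 0 ≤ t → NormX (seg r x t) ≤ σ (NormX x0) t) := by
  have ha := hexp_pos hp
  have ha1 : hexp p ≤ 1 := by
    unfold hexp
    have : 0 ≤ p.toReal⁻¹ := by positivity
    linarith
  rcases hX with ⟨rfl, rfl⟩ | ⟨rfl, rfl⟩
  · exact abstract_main r hr f L hf (hexp p) ha hFC _ _ _ (goodX_sob hr hf hp)
  · exact abstract_main r hr f L hf (hexp p) ha hFC _ _ _ (goodX_hol hr hf ha ha1)
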